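/- Let s, y be complex random variables with E[s] = 0, E[|s|²] = p > 0, and suppose y = g s + e where g ∈ ℂ is a constant with the uncorrelated effective-noise property E[s* e] = 0 and E[|e|²] = σ_e² > 0. Then the mutual information satisfies I(s; y) ≥ log₂(1 + |g|² p / σ_e²) when s is circularly symmetric Gaussian. (Worst-case-noise lower bound: Gaussian noise uncorrelated with the signal minimizes mutual information for fixed second moments.) -/

import Mathlib

open MeasureTheory ProbabilityTheory
open scoped NNReal Classical

/-- Kullback–Leibler divergence measured in bits (base-2 logarithm); takes the
value `⊤` when `μ` is not absolutely continuous w.r.t. `ν` or the log-density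
is not integrable. -/
noncomputable def klDivBits {α : Type*} [MeasurableSpace α] (μ ν : Measure α) : EReal :=
  if μ ≪ ν ∧ Integrable (fun x => Real.logb 2 (μ.rnDeriv ν x).toReal) μ then
    ((∫ x, Real.logb 2 (μ.rnDeriv ν x).toReal ∂μ : ℝ) : EReal)
  else ⊤

/-- Mutual information (in bits) between two random variables, defined as the
KL divergence between the joint law and the product of the marginals. -/
noncomputable def mutualInfoBits {Ω α β : Type*} [MeasurableSpace Ω]
    [MeasurableSpace α] [MeasurableSpace β]
    (μ : Measure Ω) (s : Ω → α) (y : Ω → β) : EReal :=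
  klDivBits (μ.map (fun ω => (s ω, y ω))) ((μ.map s).prod (μ.map y))

/-- The circularly-symmetric complex Gaussian distribution `CN(0, p)`:
real and imaginary parts are independent `N(0, p/2)`. -/
noncomputable def complexGaussian (p : ℝ≥0) : Measure ℂ :=
  Measure.map (fun xy : ℝ × ℝ => (xy.1 : ℂ) + (xy.2 : ℂ) * Complex.I)
    ((gaussianReal 0 (p / 2)).prod (gaussianReal 0 (p / 2)))

/-- **Gibbs' inequality**: among densities `F` of total mass at most one, the log-density
`dP/dν` has the largest `P`-expectation. -/
theorem integral_log_le_integral_log_rnDeriv {α : Type*} [MeasurableSpace α]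
    {P ν : Measure α} [IsProbabilityMeasure P] [SigmaFinite ν] (hac : P ≪ ν)
    {F : α → ℝ} (hF : Measurable F) (hpos : ∀ x, 0 < F x)
    (hmass : ∫⁻ x, ENNReal.ofReal (F x) ∂ν ≤ 1)
    (hlogF : Integrable (fun x => Real.log (F x)) P)
    (hlogr : Integrable (fun x => Real.log (P.rnDeriv ν x).toReal) P) :
    ∫ x, Real.log (F x) ∂P ≤ ∫ x, Real.log (P.rnDeriv ν x).toReal ∂P := by
  set r : α → ℝ := fun x => (P.rnDeriv ν x).toReal with hr
  have hr_meas : Measurable r := (Measure.measurable_rnDeriv P ν).ennreal_toReal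
  have hr_pos : ∀ᵐ x ∂P, 0 < r x := by
    filter_upwards [Measure.rnDeriv_pos hac, hac.ae_le (Measure.rnDeriv_ne_top P ν)] with x h h'
    exact ENNReal.toReal_pos h.ne' h'
  have hquot : ∫⁻ x, ENNReal.ofReal (F x / r x) ∂P ≤ 1 := by
    have hmeas : AEMeasurable (fun x => ENNReal.ofReal (F x / r x)) ν :=
      (hF.div hr_meas).ennreal_ofReal.aemeasurable
    rw [← lintegral_rnDeriv_mul hac hmeas]
    refine (lintegral_mono_ae ?_).trans hmass
    filter_upwards [Measure.rnDeriv_ne_top P ν] with x hx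
    rw [← ENNReal.ofReal_toReal hx, ← ENNReal.ofReal_mul ENNReal.toReal_nonneg]
    refine ENNReal.ofReal_le_ofReal ?_
    rcases eq_or_ne (r x) 0 with h | h
    · change r x * _ ≤ _
      rw [h, zero_mul]
      exact (hpos x).le
    · exact (mul_div_cancel₀ (F x) h).le
  have hnn : ∀ x, 0 ≤ F x / r x := fun x => div_nonneg (hpos x).le ENNReal.toReal_nonneg
  have hquot_int : Integrable (fun x => F x / r x) P := by
    refine ⟨(hF.div hr_meas).aestronglyMeasurable, ?_⟩
    rw [hasFiniteIntegral_iff_ofReal (.of_forall hnn)]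
    exact hquot.trans_lt ENNReal.one_lt_top
  have hquot_le : ∫ x, F x / r x ∂P ≤ 1 := by
    rw [integral_eq_lintegral_of_nonneg_ae (.of_forall hnn)
      (hF.div hr_meas).aestronglyMeasurable]
    exact ENNReal.toReal_le_of_le_ofReal zero_le_one (by simpa using hquot)
  have hmono : ∫ x, Real.log (F x) - Real.log (r x) ∂P ≤ ∫ x, (F x / r x - 1) ∂P := by
    refine integral_mono_ae (hlogF.sub hlogr) (hquot_int.sub (integrable_const _)) ?_
    filter_upwards [hr_pos] with x hx
    rw [← Real.log_div (hpos x).ne' hx.ne']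
    exact Real.log_le_sub_one_of_pos (div_pos (hpos x) hx)
  rw [integral_sub hlogF hlogr, integral_sub hquot_int (integrable_const _)] at hmono
  simp only [integral_const, probReal_univ, smul_eq_mul, mul_one] at hmono
  linarith

/-- A lower bound on the divergence in bits from a reference density. -/
theorem le_klDivBits {α : Type*} [MeasurableSpace α]
    {P ν : Measure α} [IsProbabilityMeasure P] [SigmaFinite ν]
    {F : α → ℝ} (hF : Measurable F) (hpos : ∀ x, 0 < F x)
    (hmass : ∫⁻ x, ENNReal.ofReal (F x) ∂ν ≤ 1)
    (hlogF : Integrable (fun x => Real.log (F x)) P) :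
    (((∫ x, Real.log (F x) ∂P) / Real.log 2 : ℝ) : EReal) ≤ klDivBits P ν := by
  unfold klDivBits
  split_ifs with h
  · obtain ⟨hac, hint⟩ := h
    have hlog2 : 0 < Real.log 2 := Real.log_pos one_lt_two
    have hlogr : Integrable (fun x => Real.log (P.rnDeriv ν x).toReal) P := by
      refine (hint.mul_const (Real.log 2)).congr (.of_forall fun x => ?_)
      exact div_mul_cancel₀ _ hlog2.ne'
    simp only [Real.logb, integral_div, EReal.coe_le_coe_iff]
    refine div_le_div_of_nonneg_right ?_ hlog2.le
    exact integral_log_le_integral_log_rnDeriv hac hF hpos hmass hlogF hlogr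
  · exact le_top

/-- Likelihood ratio of `N(m, v / 2)` with respect to `N(0, p / 2)`. -/
noncomputable def gaussianRatio (p v : ℝ≥0) (m x : ℝ) : ℝ :=
  gaussianPDFReal m (v / 2) x / gaussianPDFReal 0 (p / 2) x

theorem gaussianRatio_pos {p v : ℝ≥0} (hp : p ≠ 0) (hv : v ≠ 0) (m x : ℝ) :
    0 < gaussianRatio p v m x :=
  div_pos (gaussianPDFReal_pos _ _ _ (by simpa using hv))
    (gaussianPDFReal_pos _ _ _ (by simpa using hp))

theorem gaussianRatio_eq {p v : ℝ≥0} (hp : p ≠ 0) (hv : v ≠ 0) (m x : ℝ) :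
    gaussianRatio p v m x = √((p : ℝ) / v) * Real.exp (x ^ 2 / p - (x - m) ^ 2 / v) := by
  have hp' : (0 : ℝ) < p := by positivity
  have hv' : (0 : ℝ) < v := by positivity
  simp only [gaussianRatio, gaussianPDFReal, NNReal.coe_div, NNReal.coe_ofNat]
  rw [mul_div_mul_comm, ← Real.exp_sub, inv_div_inv, ← Real.sqrt_div (by positivity)]
  congr 2 <;> field_simp
  ring

theorem Measurable.gaussianRatio {α : Type*} [MeasurableSpace α] (p v : ℝ≥0) {m x : α → ℝ}
    (hm : Measurable m) (hx : Measurable x) :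
    Measurable fun ω => gaussianRatio p v (m ω) (x ω) := by
  have h (c : α → ℝ) (hc : Measurable c) (w : ℝ≥0) :
      Measurable fun ω => gaussianPDFReal (c ω) w (x ω) := by
    simp only [gaussianPDFReal]
    exact (((hx.sub hc).pow_const 2).neg.div_const _).exp.const_mul _
  exact (h m hm _).div (h _ measurable_const _)

theorem lintegral_gaussianRatio {p v : ℝ≥0} (hp : p ≠ 0) (hv : v ≠ 0) (m : ℝ) :
    ∫⁻ x, ENNReal.ofReal (gaussianRatio p v m x) ∂(gaussianReal 0 (p / 2)) = 1 := by
  have hp2 : p / 2 ≠ 0 := by simpa using hp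
  have hmeas : Measurable (gaussianRatio p v m) :=
    measurable_const.gaussianRatio p v measurable_id
  rw [gaussianReal_of_var_ne_zero _ hp2,
    lintegral_withDensity_eq_lintegral_mul _ (measurable_gaussianPDF _ _) hmeas.ennreal_ofReal,
    ← lintegral_gaussianPDF_eq_one m (v := v / 2) (by simpa using hv)]
  refine lintegral_congr fun x => ?_
  rw [Pi.mul_apply, gaussianPDF, gaussianPDF,
    ← ENNReal.ofReal_mul (gaussianPDFReal_nonneg _ _ _), gaussianRatio,
    mul_div_cancel₀ _ (gaussianPDFReal_pos _ _ _ hp2).ne']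

/-- Likelihood ratio of `CN(w, v)` with respect to `CN(0, p)`. -/
noncomputable def complexGaussianRatio (p v : ℝ≥0) (w z : ℂ) : ℝ :=
  gaussianRatio p v w.re z.re * gaussianRatio p v w.im z.im

theorem complexGaussianRatio_pos {p v : ℝ≥0} (hp : p ≠ 0) (hv : v ≠ 0) (w z : ℂ) :
    0 < complexGaussianRatio p v w z :=
  mul_pos (gaussianRatio_pos hp hv _ _) (gaussianRatio_pos hp hv _ _)

theorem Measurable.complexGaussianRatio {α : Type*} [MeasurableSpace α] (p v : ℝ≥0)
    {w z : α → ℂ} (hw : Measurable w) (hz : Measurable z) :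
    Measurable fun ω => complexGaussianRatio p v (w ω) (z ω) :=
  ((Complex.measurable_re.comp hw).gaussianRatio p v (Complex.measurable_re.comp hz)).mul
    ((Complex.measurable_im.comp hw).gaussianRatio p v (Complex.measurable_im.comp hz))

theorem log_complexGaussianRatio {p v : ℝ≥0} (hp : p ≠ 0) (hv : v ≠ 0) (w z : ℂ) :
    Real.log (complexGaussianRatio p v w z) =
      Real.log ((p : ℝ) / v) + Complex.normSq z / p - Complex.normSq (z - w) / v := by
  have hp' : (0 : ℝ) < p := by positivity
  have hv' : (0 : ℝ) < v := by positivity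
  rw [complexGaussianRatio, gaussianRatio_eq hp hv, gaussianRatio_eq hp hv,
    mul_mul_mul_comm, Real.mul_self_sqrt (by positivity), ← Real.exp_add,
    Real.log_mul (by positivity) (Real.exp_ne_zero _), Real.log_exp]
  simp only [Complex.normSq_apply, Complex.sub_re, Complex.sub_im]
  ring

theorem lintegral_complexGaussianRatio {p v : ℝ≥0} (hp : p ≠ 0) (hv : v ≠ 0) (w : ℂ) :
    ∫⁻ z, ENNReal.ofReal (complexGaussianRatio p v w z) ∂(complexGaussian p) = 1 := by
  have hmeas : Measurable (complexGaussianRatio p v w) :=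
    measurable_const.complexGaussianRatio p v measurable_id
  have hmeas' (m : ℝ) : Measurable (gaussianRatio p v m) :=
    measurable_const.gaussianRatio p v measurable_id
  rw [complexGaussian, lintegral_map hmeas.ennreal_ofReal (by fun_prop)]
  simp only [complexGaussianRatio, Complex.add_re, Complex.add_im, Complex.ofReal_re,
    Complex.ofReal_im, Complex.re_ofReal_mul, Complex.im_ofReal_mul, Complex.I_re, Complex.I_im,
    mul_zero, mul_one, add_zero, zero_add]
  simp only [ENNReal.ofReal_mul (gaussianRatio_pos hp hv _ _).le]
  rw [lintegral_prod_mul (hmeas' _).ennreal_ofReal.aemeasurable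
    (hmeas' _).ennreal_ofReal.aemeasurable,
    lintegral_gaussianRatio hp hv, lintegral_gaussianRatio hp hv, one_mul]

theorem integrable_normSq_complexGaussian (p : ℝ≥0) :
    Integrable (fun z => Complex.normSq z) (complexGaussian p) := by
  have hsq : Integrable (fun x : ℝ => x ^ 2) (gaussianReal 0 (p / 2)) :=
    (memLp_id_gaussianReal 2).integrable_sq
  rw [complexGaussian, integrable_map_measure
    Complex.continuous_normSq.aestronglyMeasurable (by fun_prop)]
  refine ((hsq.comp_fst (gaussianReal 0 (p / 2))).add
    (hsq.comp_snd (gaussianReal 0 (p / 2)))).congr (.of_forall fun x => ?_)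
  simp [Complex.normSq_apply, sq]

theorem integral_normSq_complexGaussian (p : ℝ≥0) :
    ∫ z, Complex.normSq z ∂(complexGaussian p) = p := by
  have hsq : Integrable (fun x : ℝ => x ^ 2) (gaussianReal 0 (p / 2)) :=
    (memLp_id_gaussianReal 2).integrable_sq
  have hvar : ∫ x, x ^ 2 ∂(gaussianReal 0 (p / 2)) = p / 2 := by
    have h := variance_id_gaussianReal (μ := 0) (v := p / 2)
    rw [variance_of_integral_eq_zero aemeasurable_id (by simp)] at h
    simpa using h
  rw [complexGaussian, integral_map (by fun_prop)
    Complex.continuous_normSq.aestronglyMeasurable]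
  have h : ∀ x : ℝ × ℝ, Complex.normSq ((x.1 : ℂ) + (x.2 : ℂ) * Complex.I)
      = x.1 ^ 2 + x.2 ^ 2 := fun x => by simp [Complex.normSq_apply, sq]
  simp only [h]
  rw [integral_add (hsq.comp_fst _) (hsq.comp_snd _),
    integral_fun_fst (fun x : ℝ => x ^ 2), integral_fun_snd (fun x : ℝ => x ^ 2), hvar]
  simp

/-- Second moment of `b s - a e` for orthogonal `s`, `e`. -/
theorem integral_normSq_sub_of_orthogonal {Ω : Type*} [MeasurableSpace Ω] {μ : Measure Ω}
    {s e : Ω → ℂ} (hs : Integrable (fun ω => Complex.normSq (s ω)) μ)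
    (he : Integrable (fun ω => Complex.normSq (e ω)) μ)
    (hse : Integrable (fun ω => star (s ω) * e ω) μ)
    (horth : ∫ ω, star (s ω) * e ω ∂μ = 0) (b a : ℂ) :
    Integrable (fun ω => Complex.normSq (b * s ω - a * e ω)) μ ∧
      ∫ ω, Complex.normSq (b * s ω - a * e ω) ∂μ =
        Complex.normSq b * ∫ ω, Complex.normSq (s ω) ∂μ +
          Complex.normSq a * ∫ ω, Complex.normSq (e ω) ∂μ := by
  have hcross : Integrable (fun ω => (star b * a * (star (s ω) * e ω)).re) μ :=
    (hse.const_mul (star b * a)).re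
  have hcross0 : ∫ ω, (star b * a * (star (s ω) * e ω)).re ∂μ = 0 := by
    have h := integral_re (hse.const_mul (star b * a))
    rw [integral_const_mul, horth, mul_zero] at h
    simpa using h
  have hexp : ∀ ω, Complex.normSq (b * s ω - a * e ω) =
      Complex.normSq b * Complex.normSq (s ω) + Complex.normSq a * Complex.normSq (e ω)
        - 2 * (star b * a * (star (s ω) * e ω)).re := by
    intro ω
    simp [Complex.normSq_apply]
    ring
  simp only [hexp]
  have h1 := hs.const_mul (Complex.normSq b)
  have h2 := he.const_mul (Complex.normSq a)
  have h3 := hcross.const_mul 2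
  have h12 : Integrable (fun ω => Complex.normSq b * Complex.normSq (s ω) +
      Complex.normSq a * Complex.normSq (e ω)) μ := h1.add h2
  refine ⟨h12.sub h3, ?_⟩
  rw [integral_sub h12 h3, integral_add h1 h2, integral_const_mul, integral_const_mul,
    integral_const_mul, hcross0]
  ring

/-- Médard-style worst-case-noise bound: if `y = g s + e`
with `s ~ CN(0,p)`, `p > 0`, `E[s* e] = 0`, `E[e] = 0`, `E[|e|²] = σ_e² > 0`,
then `I(s;y) ≥ log₂(1 + |g|² p / σ_e²)`. -/
theorem mutual_information_worst_case_noise_bound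
    {Ω : Type*} [MeasurableSpace Ω] (μ : Measure Ω) [IsProbabilityMeasure μ]
    (s y : Ω → ℂ) (hs : Measurable s) (hy : Measurable y)
    (g : ℂ) (p : ℝ≥0) (hp : 0 < p) (σe2 : ℝ) (hσ : 0 < σe2)
    (hsdist : μ.map s = complexGaussian p)
    (e : Ω → ℂ) (he : e = fun ω => y ω - g * s ω)
    (he_int : Integrable e μ) (he_mean : ∫ ω, e ω ∂μ = 0)
    (hse_int : Integrable (fun ω => star (s ω) * e ω) μ)
    (huncorr : ∫ ω, star (s ω) * e ω ∂μ = 0)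
    (he2_int : Integrable (fun ω => Complex.normSq (e ω)) μ)
    (hvar : ∫ ω, Complex.normSq (e ω) ∂μ = σe2) :
    ((Real.logb 2 (1 + Complex.normSq g * (p : ℝ) / σe2) : ℝ) : EReal)
      ≤ mutualInfoBits μ s y := by
  have hp0 : p ≠ 0 := hp.ne'
  have hpR : (0 : ℝ) < p := hp
  have hG : 0 ≤ Complex.normSq g := Complex.normSq_nonneg g
  set T : ℝ := Complex.normSq g * p + σe2 with hT
  have hTpos : 0 < T := by positivity
  -- the linear MMSE estimator `a * y` of `s` and its error `v`
  let v : ℝ≥0 := ⟨p * σe2 / T, by positivity⟩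
  have hvR : (v : ℝ) = p * σe2 / T := rfl
  have hv0 : v ≠ 0 := by
    rw [← NNReal.coe_ne_zero, hvR]
    positivity
  set a : ℂ := star g * ((p / T : ℝ) : ℂ) with ha
  have hnormSq_a : Complex.normSq a = Complex.normSq g * (p / T) ^ 2 := by
    rw [ha, Complex.normSq_mul, Complex.normSq_ofReal, Complex.star_def, Complex.normSq_conj]
    ring
  have hcoef : 1 - a * g = ((σe2 / T : ℝ) : ℂ) := by
    have h : a * g = ((Complex.normSq g * (p / T) : ℝ) : ℂ) := by
      rw [ha, Complex.ofReal_mul, Complex.normSq_eq_conj_mul_self, Complex.star_def]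
      ring
    rw [h, ← Complex.ofReal_one, ← Complex.ofReal_sub]
    congr 1
    field_simp
    rw [hT]
    ring
  have hs_sq : Integrable (fun ω => Complex.normSq (s ω)) μ := by
    have h := integrable_normSq_complexGaussian p
    rw [← hsdist] at h
    exact h.comp_measurable hs
  have hs_mom : ∫ ω, Complex.normSq (s ω) ∂μ = p := by
    rw [← integral_normSq_complexGaussian p, ← hsdist,
      integral_map hs.aemeasurable Complex.continuous_normSq.aestronglyMeasurable]
  obtain ⟨herr_int, herr⟩ :=
    integral_normSq_sub_of_orthogonal hs_sq he2_int hse_int huncorr (1 - a * g) a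
  have herr_eq : ∀ ω, (1 - a * g) * s ω - a * e ω = s ω - a * y ω := by
    intro ω
    rw [he]
    ring
  simp only [herr_eq] at herr_int herr
  have herr_v : ∫ ω, Complex.normSq (s ω - a * y ω) ∂μ = v := by
    rw [herr, hs_mom, hvar, hnormSq_a, hcoef, Complex.normSq_ofReal, hvR]
    field_simp
    rw [hT]
    ring
  let F : ℂ × ℂ → ℝ := fun x => complexGaussianRatio p v (a * x.2) x.1
  have hFmeas : Measurable F := (measurable_snd.const_mul a).complexGaussianRatio p v measurable_fst
  have hFpos : ∀ x, 0 < F x := fun x => complexGaussianRatio_pos hp0 hv0 _ _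
  have hsy : Measurable fun ω => (s ω, y ω) := hs.prodMk hy
  have : IsProbabilityMeasure (μ.map s) := Measure.isProbabilityMeasure_map hs.aemeasurable
  have : IsProbabilityMeasure (μ.map y) := Measure.isProbabilityMeasure_map hy.aemeasurable
  have : IsProbabilityMeasure (μ.map fun ω => (s ω, y ω)) :=
    Measure.isProbabilityMeasure_map hsy.aemeasurable
  have hmass : ∫⁻ x, ENNReal.ofReal (F x) ∂((μ.map s).prod (μ.map y)) ≤ 1 := by
    rw [lintegral_prod_symm _ hFmeas.ennreal_ofReal.aemeasurable, hsdist]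
    simp [F, lintegral_complexGaussianRatio hp0 hv0]
  have hlog : ∀ ω, Real.log (F (s ω, y ω)) = Real.log ((p : ℝ) / v) +
      Complex.normSq (s ω) / p - Complex.normSq (s ω - a * y ω) / v :=
    fun ω => log_complexGaussianRatio hp0 hv0 _ _
  have hlogmeas : Measurable fun x => Real.log (F x) := hFmeas.log
  have hsum_int : Integrable
      (fun ω => Real.log ((p : ℝ) / v) + Complex.normSq (s ω) / p) μ :=
    (integrable_const _).add (hs_sq.div_const _)
  have hlogF : Integrable (fun x => Real.log (F x)) (μ.map fun ω => (s ω, y ω)) := by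
    rw [integrable_map_measure hlogmeas.aestronglyMeasurable hsy.aemeasurable]
    exact (hsum_int.sub (herr_int.div_const _)).congr (.of_forall fun ω => (hlog ω).symm)
  have hvalue : ∫ x, Real.log (F x) ∂(μ.map fun ω => (s ω, y ω)) =
      Real.log (1 + Complex.normSq g * p / σe2) := by
    rw [integral_map hsy.aemeasurable hlogmeas.aestronglyMeasurable]
    simp only [hlog]
    rw [integral_sub hsum_int (herr_int.div_const _),
      integral_add (integrable_const _) (hs_sq.div_const _), integral_div, integral_div,
      hs_mom, herr_v, div_self hpR.ne', div_self (NNReal.coe_ne_zero.mpr hv0)]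
    simp only [integral_const, probReal_univ, smul_eq_mul, one_mul, add_sub_cancel_right]
    congr 1
    rw [hvR]
    field_simp
    rw [hT]
    ring
  have hbound := le_klDivBits hFmeas hFpos hmass hlogF
  rw [hvalue] at hbound
  exact hbound
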